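/- Let Y be an integrable real-valued random variable, let ε ~ N(0, σ²), σ > 0, be independent of Y, set Ŷ = Y − ε, and let p denote the (everywhere positive, smooth) density of Ŷ. Define the Tweedie-corrected prediction Ŷ^T = Ŷ + σ²·p′(Ŷ)/p(Ŷ). Then Ŷ^T is integrable and E[Ŷ^T] = E[Y]; that is, the Tweedie correction is unbiased for the population mean of the true outcome. -/

import Mathlib

open MeasureTheory ProbabilityTheory

/-- The Gaussian-smoothed density of `Ŷ = Y − ε`: `p(ŷ) = ∫ φ_σ(ŷ − y) dμ(y)`,
where `μ` is the law of `Y` and `φ_σ` is the `N(0, σ²)` density. -/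
noncomputable def smoothedDensity (μ : Measure ℝ) (σ : ℝ) (t : ℝ) : ℝ :=
  ∫ y, gaussianPDFReal 0 (Real.toNNReal (σ ^ 2)) (t - y) ∂μ

lemma tw_hasDerivAt {v : NNReal} (hv : v ≠ 0) (x : ℝ) :
    HasDerivAt (gaussianPDFReal 0 v) (-(x / v) * gaussianPDFReal 0 v x) x := by
  have hv' : (v : ℝ) ≠ 0 := by exact_mod_cast hv
  have h1 : HasDerivAt (fun x : ℝ => -(x - 0) ^ 2 / (2 * v)) (-(x / v)) x := by
    have h := ((((hasDerivAt_id x).sub_const 0).pow 2).neg).div_const (2 * (v : ℝ))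
    refine h.congr_deriv ?_
    simp
    field_simp
  have h2 := h1.exp.const_mul ((√(2 * Real.pi * v))⁻¹)
  rw [gaussianPDFReal_def]
  refine h2.congr_deriv ?_
  ring

lemma tw_bound {v : NNReal} (hv : v ≠ 0) :
    ∃ C : ℝ, ∀ x : ℝ, ‖-(x / v) * gaussianPDFReal 0 v x‖ ≤ C := by
  have hv' : 0 < (v : ℝ) := by exact_mod_cast pos_iff_ne_zero.mpr hv
  refine ⟨(√(2 * Real.pi * v))⁻¹ * ((1 + 2 * v) / v), fun x => ?_⟩
  have hc : 0 ≤ (√(2 * Real.pi * v))⁻¹ := by positivity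
  rw [gaussianPDFReal_def, norm_mul, norm_mul, norm_neg, norm_div, Real.norm_eq_abs,
    Real.norm_of_nonneg hv'.le, Real.norm_of_nonneg hc, Real.norm_of_nonneg (Real.exp_pos _).le]
  have key : |x| * Real.exp (-(x - 0) ^ 2 / (2 * v)) ≤ 1 + 2 * v := by
    have e : -(x - 0) ^ 2 / (2 * (v : ℝ)) = -(x ^ 2 / (2 * v)) := by ring
    rw [e, Real.exp_neg, ← div_eq_mul_inv, div_le_iff₀ (Real.exp_pos _)]
    have h1 := Real.add_one_le_exp (x ^ 2 / (2 * (v : ℝ)))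
    have h2 : |x| ≤ (1 + 2 * v) * (x ^ 2 / (2 * v) + 1) := by
      have : (1 + 2 * (v : ℝ)) * (x ^ 2 / (2 * v) + 1)
          = x ^ 2 / (2 * v) + 1 + x ^ 2 + 2 * v := by field_simp; ring
      rw [this]
      have h3 : 0 ≤ x ^ 2 / (2 * (v : ℝ)) := by positivity
      nlinarith [sq_nonneg (|x| - 1), sq_abs x, abs_nonneg x]
    exact h2.trans (by gcongr)
  calc _ = (√(2 * Real.pi * v))⁻¹ * ((|x| * Real.exp (-(x - 0) ^ 2 / (2 * v))) / v) := by ring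
    _ ≤ _ := by gcongr

lemma tw_gauss_bound (v : NNReal) (x : ℝ) :
    ‖gaussianPDFReal 0 v x‖ ≤ (√(2 * Real.pi * v))⁻¹ := by
  have hc : 0 ≤ (√(2 * Real.pi * v))⁻¹ := by positivity
  rw [Real.norm_of_nonneg (gaussianPDFReal_nonneg _ _ _), gaussianPDFReal_def]
  refine mul_le_of_le_one_right hc (Real.exp_le_one_iff.mpr ?_)
  have : 0 ≤ (x - 0) ^ 2 / (2 * (v : ℝ)) := by positivity
  rw [neg_div]; linarith

lemma tw_int_gauss (μ : Measure ℝ) [IsProbabilityMeasure μ] (v : NNReal) (t : ℝ) :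
    Integrable (fun y => gaussianPDFReal 0 v (t - y)) μ := by
  refine Integrable.of_bound (C := (√(2 * Real.pi * v))⁻¹) ?_ (.of_forall fun y => tw_gauss_bound v _)
  exact ((measurable_gaussianPDFReal 0 v).comp (measurable_const.sub measurable_id)).aestronglyMeasurable

lemma tw_meas_d (v : NNReal) : Measurable (fun x : ℝ => -(x / v) * gaussianPDFReal 0 v x) :=
  ((measurable_id.div_const _).neg).mul (measurable_gaussianPDFReal 0 v)

lemma tw_deriv (μ : Measure ℝ) [IsProbabilityMeasure μ] {σ : ℝ}
    (hv : Real.toNNReal (σ ^ 2) ≠ 0) (t : ℝ) :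
    HasDerivAt (smoothedDensity μ σ)
      (∫ y, -((t - y) / (Real.toNNReal (σ ^ 2) : ℝ)) *
        gaussianPDFReal 0 (Real.toNNReal (σ ^ 2)) (t - y) ∂μ) t := by
  set v := Real.toNNReal (σ ^ 2) with hvdef
  obtain ⟨C, hC⟩ := tw_bound hv
  refine (hasDerivAt_integral_of_dominated_loc_of_deriv_le (μ := μ) (𝕜 := ℝ)
    (F := fun t y => gaussianPDFReal 0 v (t - y))
    (F' := fun t y => -((t - y) / (v : ℝ)) * gaussianPDFReal 0 v (t - y))
    (bound := fun _ => C) (s := Set.univ) Filter.univ_mem ?_ (tw_int_gauss μ v t) ?_ ?_ (integrable_const _) ?_).2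
  · exact .of_forall fun s => (tw_int_gauss μ v s).aestronglyMeasurable
  · exact ((tw_meas_d v).comp (measurable_const.sub measurable_id)).aestronglyMeasurable
  · exact .of_forall fun y s _ => hC (s - y)
  · exact .of_forall fun y s _ => (tw_hasDerivAt hv (s - y)).comp_sub_const s y

lemma tw_pos (μ : Measure ℝ) [IsProbabilityMeasure μ] {σ : ℝ}
    (hv : Real.toNNReal (σ ^ 2) ≠ 0) (t : ℝ) : 0 < smoothedDensity μ σ t := by
  rw [smoothedDensity, integral_pos_iff_support_of_nonneg
    (fun y => gaussianPDFReal_nonneg _ _ _) (tw_int_gauss μ _ t)]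
  have : Function.support (fun y => gaussianPDFReal 0 (Real.toNNReal (σ ^ 2)) (t - y)) = Set.univ :=
    Set.eq_univ_of_forall fun y => (gaussianPDFReal_pos _ _ _ hv).ne'
  rw [this]; simp

lemma tw_law {Ω : Type*} [MeasurableSpace Ω] (P : Measure Ω) [IsProbabilityMeasure P]
    (Y ε : Ω → ℝ) (σ : ℝ) (hv : Real.toNNReal (σ ^ 2) ≠ 0)
    (hY : Measurable Y) (hε : Measurable ε)
    (hindep : IndepFun Y ε P)
    (hεlaw : P.map ε = gaussianReal 0 (Real.toNNReal (σ ^ 2))) :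
    P.map (fun ω => Y ω - ε ω) =
      volume.withDensity (fun t => ENNReal.ofReal (smoothedDensity (P.map Y) σ t)) := by
  have : IsProbabilityMeasure (P.map Y) := Measure.isProbabilityMeasure_map hY.aemeasurable
  set v := Real.toNNReal (σ ^ 2) with hvdef
  have hprod := (indepFun_iff_map_prod_eq_prod_map_map hY.aemeasurable hε.aemeasurable).1 hindep
  have hm : Measurable (fun z : ℝ × ℝ => z.1 - z.2) := measurable_fst.sub measurable_snd
  have e1 : P.map (fun ω => Y ω - ε ω) =
      ((P.map Y).prod (P.map ε)).map (fun z : ℝ × ℝ => z.1 - z.2) := by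
    rw [← hprod, Measure.map_map hm (hY.prodMk hε)]; rfl
  rw [e1, hεlaw]
  ext s hs
  have hg := measurable_gaussianPDF 0 v
  have hi : Measurable (s.indicator (1 : ℝ → ENNReal)) := measurable_one.indicator hs
  rw [← lintegral_indicator_one hs, lintegral_map hi hm,
    lintegral_prod (fun z : ℝ × ℝ => s.indicator (1 : ℝ → ENNReal) (z.1 - z.2))
      (hi.comp hm).aemeasurable, withDensity_apply _ hs]
  calc ∫⁻ y, ∫⁻ e, s.indicator 1 (y - e) ∂(gaussianReal 0 v) ∂(P.map Y)
      = ∫⁻ y, (∫⁻ t, gaussianPDF 0 v (t - y) * s.indicator 1 t) ∂(P.map Y) := by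
        refine lintegral_congr fun y => ?_
        rw [gaussianReal_of_var_ne_zero 0 hv, lintegral_withDensity_eq_lintegral_mul _ hg
          (g := fun e => s.indicator (1 : ℝ → ENNReal) (y - e)) (hi.comp (measurable_const.sub measurable_id))]
        rw [← lintegral_sub_left_eq_self (μ := volume) (fun e => (gaussianPDF 0 v * fun e => s.indicator (1 : ℝ → ENNReal) (y - e)) e) y]
        refine lintegral_congr fun t => ?_
        simp only [Pi.mul_apply, Function.comp, sub_sub_cancel]
        congr 1
        simp only [gaussianPDF, gaussianPDFReal_def]
        congr 4
        ring
    _ = ∫⁻ t, ∫⁻ y, gaussianPDF 0 v (t - y) * s.indicator 1 t ∂(P.map Y) := by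
        refine lintegral_lintegral_swap (Measurable.aemeasurable ?_)
        exact (hg.comp (measurable_snd.sub measurable_fst)).mul (hi.comp measurable_snd)
    _ = ∫⁻ t, s.indicator (fun t => ENNReal.ofReal (smoothedDensity (P.map Y) σ t)) t := by
        refine lintegral_congr fun t => ?_
        rw [lintegral_mul_const (f := fun y => gaussianPDF 0 v (t - y)) _ (hg.comp (measurable_const.sub measurable_id))]
        have : ∫⁻ y, gaussianPDF 0 v (t - y) ∂(P.map Y)
            = ENNReal.ofReal (smoothedDensity (P.map Y) σ t) := by
          rw [smoothedDensity, ofReal_integral_eq_lintegral_ofReal (tw_int_gauss _ _ t)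
            (.of_forall fun y => gaussianPDFReal_nonneg _ _ _)]
          rfl
        rw [this]
        by_cases h : t ∈ s <;> simp [h]
    _ = _ := lintegral_indicator hs _

lemma tw_int_d {v : NNReal} (hv : v ≠ 0) :
    Integrable (fun x : ℝ => -(x / v) * gaussianPDFReal 0 v x) ∧
      ∫ x : ℝ, -(x / v) * gaussianPDFReal 0 v x = 0 := by
  have h1 : Integrable (fun x : ℝ => x) (gaussianReal 0 v) :=
    (memLp_id_gaussianReal (μ := 0) (v := v) 1).integrable le_rfl
  have h2 : ∫ x, x ∂(gaussianReal 0 v) = 0 := integral_id_gaussianReal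
  have e : (fun x : ℝ => -(x / v) * gaussianPDFReal 0 v x) =
      fun x => (-(v : ℝ)⁻¹) * (gaussianPDFReal 0 v x • x) := by
    ext x; simp only [smul_eq_mul]; ring
  rw [integral_gaussianReal_eq_integral_smul hv] at h2
  rw [gaussianReal_of_var_ne_zero 0 hv, integrable_withDensity_iff_integrable_smul'
    (measurable_gaussianPDF _ _) (.of_forall fun _ => gaussianPDF_lt_top)] at h1
  simp only [toReal_gaussianPDF] at h1
  rw [e]
  refine ⟨h1.const_mul _, ?_⟩
  rw [integral_const_mul, h2, mul_zero]

lemma tw_int_deriv (μ : Measure ℝ) [IsProbabilityMeasure μ] {σ : ℝ}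
    (hv : Real.toNNReal (σ ^ 2) ≠ 0) :
    Integrable (deriv (smoothedDensity μ σ)) ∧ ∫ t, deriv (smoothedDensity μ σ) t = 0 := by
  have e : deriv (smoothedDensity μ σ) = fun t => _ := funext fun t => (tw_deriv μ hv t).deriv
  rw [e]
  set v := Real.toNNReal (σ ^ 2) with hvdef
  obtain ⟨hd, hd0⟩ := tw_int_d hv
  have hi : Integrable (Function.uncurry fun y t : ℝ =>
      -((t - y) / (v : ℝ)) * gaussianPDFReal 0 v (t - y)) (μ.prod volume) := by
    rw [integrable_prod_iff]
    · refine ⟨.of_forall fun y => hd.comp_sub_right y, ?_⟩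
      refine (integrable_const (∫ t : ℝ, ‖-(t / (v : ℝ)) * gaussianPDFReal 0 v t‖)).congr
        (.of_forall fun y => ?_)
      exact (integral_sub_right_eq_self
        (fun t : ℝ => ‖-(t / (v : ℝ)) * gaussianPDFReal 0 v t‖) y).symm
    · exact ((tw_meas_d v).comp (measurable_snd.sub measurable_fst)).aestronglyMeasurable
  refine ⟨hi.integral_prod_right, ?_⟩
  rw [← integral_integral_swap hi]
  have : ∀ y : ℝ, ∫ t : ℝ, -((t - y) / (v : ℝ)) * gaussianPDFReal 0 v (t - y) = 0 := fun y =>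
    (integral_sub_right_eq_self (fun t : ℝ => -(t / (v : ℝ)) * gaussianPDFReal 0 v t) y).trans hd0
  simp only [this, integral_zero]

/-- **Unbiasedness of the Tweedie-corrected prediction for the population mean.**
For `Ŷ = Y − ε` with `ε ~ N(0, σ²)` independent of `Y`, the Tweedie-corrected
prediction `Ŷ^T = Ŷ + σ²·p′(Ŷ)/p(Ŷ)` is integrable and `E[Ŷ^T] = E[Y]`. -/
theorem tweedie_correction_unbiased_mean
    {Ω : Type*} [MeasurableSpace Ω] (P : Measure Ω) [IsProbabilityMeasure P]
    (Y ε : Ω → ℝ) (σ : ℝ) (hσ : 0 < σ)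
    (hYint : Integrable Y P)
    (hY : Measurable Y) (hε : Measurable ε)
    (hindep : IndepFun Y ε P)
    (hεlaw : P.map ε = gaussianReal 0 (Real.toNNReal (σ ^ 2))) :
    Integrable
      (fun ω => (Y ω - ε ω)
        + σ ^ 2 * deriv (smoothedDensity (P.map Y) σ) (Y ω - ε ω)
            / smoothedDensity (P.map Y) σ (Y ω - ε ω)) P
    ∧ ∫ ω, ((Y ω - ε ω)
        + σ ^ 2 * deriv (smoothedDensity (P.map Y) σ) (Y ω - ε ω)
            / smoothedDensity (P.map Y) σ (Y ω - ε ω)) ∂P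
      = ∫ ω, Y ω ∂P := by
  have : IsProbabilityMeasure (P.map Y) := Measure.isProbabilityMeasure_map hY.aemeasurable
  have hv : Real.toNNReal (σ ^ 2) ≠ 0 := (Real.toNNReal_pos.mpr (by positivity)).ne'
  have hlaw := tw_law P Y ε σ hv hY hε hindep hεlaw
  set p := smoothedDensity (P.map Y) σ with hp
  have hpos : ∀ t, 0 < p t := tw_pos (P.map Y) hv
  have hpm : Measurable p :=
    (continuous_iff_continuousAt.mpr fun t => (tw_deriv (P.map Y) hv t).continuousAt).measurable
  obtain ⟨hdi, hd0⟩ := tw_int_deriv (P.map Y) hv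
  rw [← hp] at hdi hd0
  have hεint : Integrable ε P ∧ ∫ ω, ε ω ∂P = 0 := by
    have h1 : Integrable (fun x : ℝ => x) (P.map ε) := by
      rw [hεlaw]; exact (memLp_id_gaussianReal 1).integrable le_rfl
    have h2 : ∫ x, x ∂(P.map ε) = 0 := by rw [hεlaw]; exact integral_id_gaussianReal
    rw [integral_map (f := fun x : ℝ => x) hε.aemeasurable aestronglyMeasurable_id] at h2
    exact ⟨h1.comp_measurable hε, h2⟩
  have hm : Measurable (fun ω => Y ω - ε ω) := hY.sub hε
  have hqm : Measurable (fun t => σ ^ 2 * deriv p t / p t) :=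
    ((measurable_deriv p).const_mul _).div hpm
  have hpe : ∀ t, (ENNReal.ofReal (p t)).toReal • (σ ^ 2 * deriv p t / p t) = σ ^ 2 * deriv p t := by
    intro t
    rw [ENNReal.toReal_ofReal (hpos t).le, smul_eq_mul]
    field_simp [(hpos t).ne']
  have hq1 : Integrable (fun t => σ ^ 2 * deriv p t / p t) (P.map fun ω => Y ω - ε ω) := by
    rw [hlaw, integrable_withDensity_iff_integrable_smul' hpm.ennreal_ofReal
      (.of_forall fun _ => ENNReal.ofReal_lt_top)]
    simp only [hpe]
    exact hdi.const_mul _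
  have hq2 : ∫ t, σ ^ 2 * deriv p t / p t ∂(P.map fun ω => Y ω - ε ω) = 0 := by
    rw [hlaw, integral_withDensity_eq_integral_toReal_smul hpm.ennreal_ofReal
      (.of_forall fun _ => ENNReal.ofReal_lt_top)]
    simp only [hpe]
    rw [integral_const_mul, hd0, mul_zero]
  rw [integral_map hm.aemeasurable hqm.aestronglyMeasurable] at hq2
  have hq1' : Integrable (fun ω => σ ^ 2 * deriv p (Y ω - ε ω) / p (Y ω - ε ω)) P :=
    hq1.comp_measurable hm
  have hsub : Integrable (fun ω => Y ω - ε ω) P := hYint.sub hεint.1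
  refine ⟨hsub.add hq1', ?_⟩
  rw [integral_add hsub hq1', hq2, integral_sub hYint hεint.1, hεint.2]
  ring
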